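/- arXiv:1809.09269 — 3 statements merged into one kernel-verified Lean document; each statement's English description precedes it below -/
import Mathlib

section
/- For every b ∈ U_j ∩ U_ℓ one has ∑_k φ_k(b) · η(j,k) = η(j,ℓ) + ∑_k φ_k(b) · η(ℓ,k), where both sums run over all k ∈ J and have only finitely many nonzero terms. -/
open scoped BigOperators

/-- Well-definedness of the weighted sum `∑ₖ φₖ(b) η(j,k)` up to the
integer `η(j,ℓ)` on overlaps, for a Čech 1-cocycle `η` and a subordinate partition
of unity `φ`. -/
theorem weighted_cocycle_sum_overlap
    {B : Type*} [TopologicalSpace B] {J : Type*}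
    (U : J → Set B) (hUopen : ∀ j, IsOpen (U j)) (hUcover : ⋃ j, U j = Set.univ)
    (φ : J → B → ℝ)
    (hφcont : ∀ j, Continuous (φ j))
    (hφnonneg : ∀ j b, 0 ≤ φ j b)
    (hφsupp : ∀ j, tsupport (φ j) ⊆ U j)
    (hφlf : LocallyFinite fun j => Function.support (φ j))
    (hφsum : ∀ b, ∑ᶠ j, φ j b = 1)
    (η : J → J → ℤ)
    (hcocycle : ∀ j k l, (U j ∩ U k ∩ U l).Nonempty → η j l = η j k + η k l)
    (j l : J) (b : B) (hb : b ∈ U j ∩ U l) :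
    ∑ᶠ k, φ k b * (η j k : ℝ) = (η j l : ℝ) + ∑ᶠ k, φ k b * (η l k : ℝ) := by
  have hfin : (Function.support fun k => φ k b).Finite := hφlf.point_finite b
  have hfin_mul (c : J → ℝ) : (Function.support fun k => φ k b * c k).Finite :=
    hfin.subset (Function.support_mul_subset_left _ _)
  have hterm (k : J) : φ k b * (η j k : ℝ) = φ k b * (η j l : ℝ) + φ k b * (η l k : ℝ) := by
    by_cases hk : φ k b = 0
    · simp [hk]
    · have hbk : b ∈ U k := hφsupp k (subset_tsupport _ hk)
      rw [hcocycle j l k ⟨b, hb, hbk⟩]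
      push_cast
      ring
  rw [finsum_congr hterm, finsum_add_distrib (hfin_mul fun _ => (η j l : ℝ)) (hfin_mul _),
    ← finsum_mul, hφsum, one_mul]
end

section
/- For every b ∈ U_j ∩ U_ℓ one has (τ(j) + ∑_k φ_k(b) · θ(j,k)) − (τ(ℓ) + ∑_k φ_k(b) · θ(ℓ,k)) = η(j,ℓ); in particular this difference is an integer, so exp(2πi(τ(j) + ∑_k φ_k(b)θ(j,k))) = exp(2πi(τ(ℓ) + ∑_k φ_k(b)θ(ℓ,k))). -/
open scoped BigOperators

/-- If `f - g` is constant equal to `c` on the support of weights of total mass one, then the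
weighted averages of `f` and `g` differ by `c`. -/
theorem finsum_mul_sub_finsum_mul_of_sub_eq {ι R : Type*} [Ring R] {w f g : ι → R} {c : R}
    (hw : (Function.support w).Finite) (hsum : ∑ᶠ k, w k = 1)
    (h : ∀ k, w k ≠ 0 → f k - g k = c) :
    ∑ᶠ k, w k * f k - ∑ᶠ k, w k * g k = c := by
  have hfin (u : ι → R) : (Function.support fun k => w k * u k).Finite :=
    hw.subset fun k hk hwk => hk (by simp [hwk])
  have hmul (k : ι) : w k * f k - w k * g k = w k * c := by
    by_cases hk : w k = 0
    · simp [hk]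
    · rw [← mul_sub, h k hk]
  rw [← finsum_sub_distrib (hfin f) (hfin g), finsum_congr hmul, ← finsum_mul' _ _ hw, hsum,
    one_mul]

/-- On overlaps `U j ∩ U ℓ`, the local expressions
`τ(j) + ∑ₖ φₖ(b) θ(j,k)` differ by the integer `η(j,ℓ)`, where
`θ(j,k) = η(j,k) + τ(k) − τ(j)`; hence their exponentials agree. -/
theorem harmonic_local_expressions_differ_by_integer
    {B : Type*} [TopologicalSpace B] {J : Type*}
    (U : J → Set B) (hUopen : ∀ j, IsOpen (U j)) (hUcover : ⋃ j, U j = Set.univ)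
    (φ : J → B → ℝ)
    (hφcont : ∀ j, Continuous (φ j))
    (hφnonneg : ∀ j b, 0 ≤ φ j b)
    (hφsupp : ∀ j, tsupport (φ j) ⊆ U j)
    (hφlf : LocallyFinite fun j => Function.support (φ j))
    (hφsum : ∀ b, ∑ᶠ j, φ j b = 1)
    (η : J → J → ℤ)
    (hcocycle : ∀ j k l, (U j ∩ U k ∩ U l).Nonempty → η j l = η j k + η k l)
    (τ : J → ℝ) (θ : J → J → ℝ)
    (hθ : ∀ j k, θ j k = (η j k : ℝ) + τ k - τ j)
    (j l : J) (b : B) (hb : b ∈ U j ∩ U l) :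
    (τ j + ∑ᶠ k, φ k b * θ j k) - (τ l + ∑ᶠ k, φ k b * θ l k) = (η j l : ℝ) ∧
    Complex.exp (2 * (Real.pi : ℂ) * Complex.I *
        ((τ j + ∑ᶠ k, φ k b * θ j k : ℝ) : ℂ)) =
      Complex.exp (2 * (Real.pi : ℂ) * Complex.I *
        ((τ l + ∑ᶠ k, φ k b * θ l k : ℝ) : ℂ)) := by
  have hdiff : ∑ᶠ k, φ k b * θ j k - ∑ᶠ k, φ k b * θ l k = (η j l : ℝ) + τ l - τ j := by
    refine finsum_mul_sub_finsum_mul_of_sub_eq (hφlf.point_finite b) (hφsum b) fun k hk => ?_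
    have hbk : b ∈ U k := hφsupp k (subset_tsupport _ hk)
    rw [hθ, hθ, hcocycle j l k ⟨b, hb, hbk⟩]
    push_cast
    ring
  have hmain : (τ j + ∑ᶠ k, φ k b * θ j k) - (τ l + ∑ᶠ k, φ k b * θ l k) = (η j l : ℝ) := by
    linear_combination hdiff
  refine ⟨hmain, Complex.exp_eq_exp_iff_exists_int.mpr ⟨η j l, ?_⟩⟩
  rw [sub_eq_iff_eq_add.mp hmain, Complex.ofReal_add, Complex.ofReal_intCast]
  ring
end

section
/- Let (M,d) be a metric space, L = {ℓ_1, …, ℓ_N} ⊆ M a finite subset of distinct points, α > 0, and for b ∈ X = ⋃_{k=1}^N B(ℓ_k, α) let φ_k(b) = max(α − d(ℓ_k,b), 0) / ∑_{m=1}^N max(α − d(ℓ_m,b), 0). Let θ, θ̄ : {1,…,N} × {1,…,N} → ℝ be functions such that θ̄(j,k) = θ(j,k) whenever B(ℓ_j, α) ∩ B(ℓ_k, α) ≠ ∅. Then for every j and every b ∈ B(ℓ_j, α), ∑_{k=1}^N φ_k(b) · θ̄(j,k) = ∑_{k=1}^N φ_k(b) · θ(j,k); consequently, for any τ : {1,…,N}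 → ℝ, exp(2πi(τ(j) + ∑_k φ_k(b) θ̄(j,k))) = exp(2πi(τ(j) + ∑_k φ_k(b) θ(j,k))). In other words, the sparse circular coordinates can be computed using cochain values on the Rips complex of the landmarks rather than on the nerve of the ball cover. -/
open scoped BigOperators

/-- Sparse circular coordinates can be computed using cochain values on
the Rips complex rather than on the nerve of the ball cover: if `θ̄` agrees with `θ`
on all pairs whose balls intersect, then the weighted sums (and hence the circular
coordinates) agree on each ball `B(ℓ_j, α)`. -/
theorem sparse_coordinates_rips_vs_nerve
    {M : Type*} [MetricSpace M] (N : ℕ) (ℓ : Fin N → M)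
    (hℓ : Function.Injective ℓ) (α : ℝ) (hα : 0 < α)
    (φ : Fin N → M → ℝ)
    (hφ : ∀ k b, φ k b =
      max (α - dist (ℓ k) b) 0 / ∑ m, max (α - dist (ℓ m) b) 0)
    (θ θbar : Fin N → Fin N → ℝ)
    (hθ : ∀ j k, (Metric.ball (ℓ j) α ∩ Metric.ball (ℓ k) α).Nonempty →
      θbar j k = θ j k)
    (τ : Fin N → ℝ)
    (j : Fin N) (b : M) (hb : b ∈ Metric.ball (ℓ j) α) :
    (∑ k, φ k b * θbar j k = ∑ k, φ k b * θ j k) ∧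
    Complex.exp (2 * (Real.pi : ℂ) * Complex.I *
        ((τ j + ∑ k, φ k b * θbar j k : ℝ) : ℂ)) =
      Complex.exp (2 * (Real.pi : ℂ) * Complex.I *
        ((τ j + ∑ k, φ k b * θ j k : ℝ) : ℂ)) := by
  have hsum : ∑ k, φ k b * θbar j k = ∑ k, φ k b * θ j k := by
    refine Finset.sum_congr rfl fun k _ => ?_
    by_cases hk : b ∈ Metric.ball (ℓ k) α
    · rw [hθ j k ⟨b, hb, hk⟩]
    · have hle : α - dist (ℓ k) b ≤ 0 := by
        rw [Metric.mem_ball', not_lt] at hk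
        exact sub_nonpos.mpr hk
      rw [hφ, max_eq_right hle, zero_div, zero_mul, zero_mul]
  exact ⟨hsum, by rw [hsum]⟩
end
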